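/- arXiv:1603.05621 — 2 statements merged into one kernel-verified Lean document; each statement's English description precedes it below -/
import Mathlib

section
/- Let A be an order-k real tensor with dimensions (d₁,…,d_k), let π₁, π₂ be any two partitions of [k], and let 2 ≤ p ≤ ∞ (with the convention 1/∞ = 0). Then [dim(A)]^{1/p − 1} · [dim_A(π₁,π₂)]^{1/2} · ‖Unfold_{π₁}(A)‖_p ≤ ‖Unfold_{π₂}(A)‖_p ≤ [dim(A)]^{1 − 1/p} · [dim_A(π₂,π₁)]^{−1/2} · ‖Unfold_{π₁}(A)‖_p. -/
open scoped BigOperators ENNReal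

namespace TensorUnfolding

/-- The vector `l^p` norm of a finitely-indexed real vector, for `p ∈ [1, ∞]`
(for `p = ∞` it is the maximum of the absolute values of the entries). -/
noncomputable def pNorm (p : ℝ≥0∞) {ι : Type} [Fintype ι] (x : ι → ℝ) : ℝ :=
  if p = ⊤ then ⨆ i, |x i| else (∑ i, |x i| ^ p.toReal) ^ (1 / p.toReal)

/-- `π` is a partition of `[k] = {0, …, k-1}`: a collection of disjoint nonempty
blocks whose union is all of `Fin k`. -/
def IsPartition {k : ℕ} (π : Finset (Finset (Fin k))) : Prop :=
  (∀ B ∈ π, B.Nonempty) ∧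
  (∀ B ∈ π, ∀ B' ∈ π, B ≠ B' → Disjoint B B') ∧
  π.sup id = Finset.univ

/-- `π₁ ≤ π₂`: every block of `π₁` is contained in some block of `π₂`. -/
def Refines {k : ℕ} (π₁ π₂ : Finset (Finset (Fin k))) : Prop :=
  ∀ B ∈ π₁, ∃ B' ∈ π₂, B ⊆ B'

/-- The finest partition `0_{[k]} = {{1}, …, {k}}`. -/
def botPartition (k : ℕ) : Finset (Finset (Fin k)) :=
  Finset.univ.image fun n => {n}

/-- The coarsest (one-block) partition `1_{[k]} = {[k]}`. -/
def topPartition (k : ℕ) : Finset (Finset (Fin k)) :=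
  {Finset.univ}

/-- The meet `π₁ ∧ π₂`: the partition whose blocks are the nonempty
intersections `B ∩ B'` with `B ∈ π₁`, `B' ∈ π₂`. -/
def meetPartition {k : ℕ} (π₁ π₂ : Finset (Finset (Fin k))) : Finset (Finset (Fin k)) :=
  ((π₁ ×ˢ π₂).image fun p => p.1 ∩ p.2).filter fun B => B.Nonempty

/-- The `l^p` operator norm of the unfolding of the tensor `A` induced by the
partition `π`: the supremum of `⟨A, ⊗_{B ∈ π} y_B⟩` over choices, for each block
`B ∈ π`, of a vector `y_B` indexed by `Π_{j ∈ B} Fin (d j)` with `l^p` norm 1. -/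
noncomputable def unfoldNormP {k : ℕ} (p : ℝ≥0∞) (d : Fin k → ℕ)
    (A : ((n : Fin k) → Fin (d n)) → ℝ) (π : Finset (Finset (Fin k))) : ℝ :=
  sSup { r : ℝ |
    ∃ y : (B : Finset (Fin k)) → ((j : B) → Fin (d j.1)) → ℝ,
      (∀ B ∈ π, pNorm p (y B) = 1) ∧
      r = ∑ i : (n : Fin k) → Fin (d n), A i * ∏ B ∈ π, y B fun j => i j.1 }

/-- The spectral norm of the unfolding of the tensor `A` induced by the
partition `π`: the supremum of `⟨A, ⊗_{B ∈ π} y_B⟩` over choices, for each block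
`B ∈ π`, of a vector `y_B` indexed by `Π_{j ∈ B} Fin (d j)` with Euclidean norm 1. -/
noncomputable def unfoldNorm {k : ℕ} (d : Fin k → ℕ)
    (A : ((n : Fin k) → Fin (d n)) → ℝ) (π : Finset (Finset (Fin k))) : ℝ :=
  sSup { r : ℝ |
    ∃ y : (B : Finset (Fin k)) → ((j : B) → Fin (d j.1)) → ℝ,
      (∀ B ∈ π, ∑ v, (y B v) ^ 2 = 1) ∧
      r = ∑ i : (n : Fin k) → Fin (d n), A i * ∏ B ∈ π, y B fun j => i j.1 }

/-- The `l^p` operator norm of the tensor `A`: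
`‖A‖_p = sup { A(x₁, …, x_k) : ‖x_n‖_p = 1 }`. -/
noncomputable def opNormP {k : ℕ} (p : ℝ≥0∞) (d : Fin k → ℕ)
    (A : ((n : Fin k) → Fin (d n)) → ℝ) : ℝ :=
  sSup { r : ℝ | ∃ x : (n : Fin k) → Fin (d n) → ℝ,
    (∀ n, pNorm p (x n) = 1) ∧
    r = ∑ i : (n : Fin k) → Fin (d n), A i * ∏ n, x n (i n) }

/-- The spectral norm of the tensor `A`:
`‖A‖_σ = sup { A(x₁, …, x_k) : ‖x_n‖₂ = 1 }`. -/
noncomputable def specNorm {k : ℕ} (d : Fin k → ℕ)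
    (A : ((n : Fin k) → Fin (d n)) → ℝ) : ℝ :=
  sSup { r : ℝ | ∃ x : (n : Fin k) → Fin (d n) → ℝ,
    (∀ n, ∑ i, (x n i) ^ 2 = 1) ∧
    r = ∑ i : (n : Fin k) → Fin (d n), A i * ∏ n, x n (i n) }

/-- The Frobenius norm of the tensor `A`. -/
noncomputable def frobNorm {k : ℕ} (d : Fin k → ℕ)
    (A : ((n : Fin k) → Fin (d n)) → ℝ) : ℝ :=
  Real.sqrt (∑ i : (n : Fin k) → Fin (d n), (A i) ^ 2)

/-- `D_A(B, B') = Π_{n ∈ B ∩ B'} d_n` if `B ∩ B' ≠ ∅`, and `0` otherwise. -/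
def blockDim {k : ℕ} (d : Fin k → ℕ) (B B' : Finset (Fin k)) : ℕ :=
  if (B ∩ B').Nonempty then ∏ n ∈ B ∩ B', d n else 0

/-- `dim_A(π₁, π₂) = Π_{B ∈ π₁} max_{B' ∈ π₂} D_A(B, B')`. -/
def dimRel {k : ℕ} (d : Fin k → ℕ) (π₁ π₂ : Finset (Finset (Fin k))) : ℕ :=
  ∏ B ∈ π₁, π₂.sup fun B' => blockDim d B B'

/-- `A` is `π`-orthogonal decomposable: `A = Σ_{n=1}^r λ_n a₁⁽ⁿ⁾ ⊗ ⋯ ⊗ a_k⁽ⁿ⁾`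
with `λ₁ ≥ ⋯ ≥ λ_r ≥ 0` and `Π_{i ∈ B} ⟨a_i⁽ⁿ⁾, a_i⁽ᵐ⁾⟩ = δ_{nm}` for every
block `B ∈ π`. -/
def IsPiOD {k : ℕ} (d : Fin k → ℕ) (A : ((n : Fin k) → Fin (d n)) → ℝ)
    (π : Finset (Finset (Fin k))) : Prop :=
  ∃ (r : ℕ) (lam : Fin r → ℝ) (a : Fin r → (n : Fin k) → Fin (d n) → ℝ),
    Antitone lam ∧ (∀ n, 0 ≤ lam n) ∧
    (∀ i, A i = ∑ n, lam n * ∏ m, a n m (i m)) ∧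
    (∀ B ∈ π, ∀ n m : Fin r,
      (∏ j ∈ B, ∑ t, a n j t * a m j t) = if n = m then 1 else 0)

end TensorUnfolding

namespace TensorUnfolding

section PNorm

variable {ι : Type} [Fintype ι] {p : ℝ≥0∞}

lemma pNorm_nonneg (p : ℝ≥0∞) (x : ι → ℝ) : 0 ≤ pNorm p x := by
  unfold pNorm
  split_ifs
  · exact Real.iSup_nonneg fun i => abs_nonneg _
  · positivity

lemma toReal_pos_of_one_le (hp : 1 ≤ p) (h : p ≠ ⊤) : 0 < p.toReal :=
  ENNReal.toReal_pos (zero_lt_one.trans_le hp).ne' h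

lemma abs_le_pNorm (hp : 1 ≤ p) (x : ι → ℝ) (i : ι) : |x i| ≤ pNorm p x := by
  unfold pNorm
  split_ifs with h
  · exact le_ciSup (f := fun i => |x i|) (Set.finite_range _).bddAbove i
  · have hq := toReal_pos_of_one_le hp h
    calc |x i| = (|x i| ^ p.toReal) ^ (1 / p.toReal) := by
          rw [one_div, Real.rpow_rpow_inv (abs_nonneg _) hq.ne']
      _ ≤ _ := by
          apply Real.rpow_le_rpow (by positivity) _ (by positivity)
          exact Finset.single_le_sum (f := fun i => |x i| ^ p.toReal)
            (fun i _ => by positivity) (Finset.mem_univ i)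

lemma pNorm_const_mul (hp : 1 ≤ p) {c : ℝ} (hc : 0 ≤ c) (x : ι → ℝ) :
    pNorm p (fun i => c * x i) = c * pNorm p x := by
  unfold pNorm
  split_ifs with h
  · simp_rw [abs_mul, abs_of_nonneg hc]
    exact (Real.mul_iSup_of_nonneg hc _).symm
  · have hq := toReal_pos_of_one_le hp h
    simp_rw [abs_mul, abs_of_nonneg hc, Real.mul_rpow hc (abs_nonneg _), ← Finset.mul_sum]
    rw [Real.mul_rpow (by positivity) (by positivity), one_div, Real.rpow_rpow_inv hc hq.ne']

lemma pNorm_neg (p : ℝ≥0∞) (x : ι → ℝ) : pNorm p (fun i => -x i) = pNorm p x := by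
  simp [pNorm]

end PNorm

variable {k : ℕ} {d : Fin k → ℕ} {π : Finset (Finset (Fin k))}

/-- The product tensor `⊗_{B ∈ π} y_B`. -/
noncomputable def blockTensor (π : Finset (Finset (Fin k)))
    (y : (B : Finset (Fin k)) → ((j : B) → Fin (d j.1)) → ℝ) (i : (n : Fin k) → Fin (d n)) : ℝ :=
  ∏ B ∈ π, y B fun j => i j.1

lemma IsPartition.exists_mem (h : IsPartition π) (n : Fin k) : ∃ B ∈ π, n ∈ B := by
  have : n ∈ π.sup id := by rw [h.2.2]; exact Finset.mem_univ n
  simpa [Finset.mem_sup] using this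

lemma IsPartition.eq_of_mem (h : IsPartition π) {B B' : Finset (Fin k)} (hB : B ∈ π)
    (hB' : B' ∈ π) {n : Fin k} (hn : n ∈ B) (hn' : n ∈ B') : B = B' := by
  by_contra hne
  exact Finset.disjoint_left.1 (h.2.1 B hB B' hB' hne) hn hn'

/-- Restricting a multi-index to the blocks of a partition is a bijection. -/
lemma IsPartition.bijective_restrict (h : IsPartition π) :
    Function.Bijective (fun (i : (n : Fin k) → Fin (d n)) (B : π) (j : B.1) => i j.1) := by
  constructor
  · intro i i' hii
    funext n
    obtain ⟨B, hB, hn⟩ := h.exists_mem n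
    exact congrFun (congrFun hii ⟨B, hB⟩) ⟨n, hn⟩
  · intro w
    choose b hb hnb using h.exists_mem
    refine ⟨fun n => w ⟨b n, hb n⟩ ⟨n, hnb n⟩, ?_⟩
    funext B j
    obtain ⟨B, hB⟩ := B
    obtain ⟨n, hn⟩ := j
    obtain rfl : B = b n := h.eq_of_mem hB (hb n) hn (hnb n)
    rfl

lemma IsPartition.sum_prod (h : IsPartition π)
    (f : (B : Finset (Fin k)) → ((j : B) → Fin (d j.1)) → ℝ) :
    ∑ i : (n : Fin k) → Fin (d n), ∏ B ∈ π, f B (fun j => i j.1) = ∏ B ∈ π, ∑ v, f B v := by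
  rw [← Finset.prod_coe_sort π (fun B => ∑ v, f B v), Finset.prod_univ_sum,
    Fintype.piFinset_univ]
  refine Fintype.sum_bijective _ h.bijective_restrict _ _ fun i => ?_
  exact (Finset.prod_coe_sort π (fun B => f B fun j => i j.1)).symm

lemma IsPartition.pNorm_blockTensor (h : IsPartition π) (hd : ∀ n, 1 ≤ d n) (p : ℝ≥0∞)
    (y : (B : Finset (Fin k)) → ((j : B) → Fin (d j.1)) → ℝ) :
    pNorm p (blockTensor π y) = ∏ B ∈ π, pNorm p (y B) := by
  have hne (n : Fin k) : Nonempty (Fin (d n)) := ⟨⟨0, hd n⟩⟩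
  unfold pNorm blockTensor
  split_ifs with hp
  · apply le_antisymm
    · refine ciSup_le fun i => ?_
      rw [Finset.abs_prod]
      exact Finset.prod_le_prod (fun _ _ => abs_nonneg _) fun B _ =>
        le_ciSup (f := fun v => |y B v|) (Set.finite_range _).bddAbove _
    · have hmax (B : Finset (Fin k)) := exists_eq_ciSup_of_finite (f := fun v => |y B v|)
      choose w hw using hmax
      obtain ⟨i, hi⟩ := h.bijective_restrict.2 (fun B : π => w B.1)
      refine le_trans (le_of_eq ?_)
        (le_ciSup (f := fun i : (n : Fin k) → Fin (d n) => |∏ B ∈ π, y B fun j => i j.1|)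
          (Set.finite_range _).bddAbove i)
      rw [Finset.abs_prod]
      refine Finset.prod_congr rfl fun B hB => ?_
      rw [← hw B, ← congrFun hi ⟨B, hB⟩]
  · simp_rw [Finset.abs_prod]
    rw [Real.finsetProd_rpow _ _ fun B _ => by positivity,
      ← h.sum_prod fun B v => |y B v| ^ p.toReal]
    congr 1
    refine Finset.sum_congr rfl fun i _ => ?_
    rw [Real.finsetProd_rpow _ _ fun B _ => abs_nonneg _]

lemma inner_blockTensor_le {p : ℝ≥0∞} (hp : 1 ≤ p) (A : ((n : Fin k) → Fin (d n)) → ℝ)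
    (π : Finset (Finset (Fin k))) (y : (B : Finset (Fin k)) → ((j : B) → Fin (d j.1)) → ℝ) :
    ∑ i, A i * blockTensor π y i ≤ unfoldNormP p d A π * ∏ B ∈ π, pNorm p (y B) := by
  by_cases hz : ∃ B ∈ π, pNorm p (y B) = 0
  · obtain ⟨B, hB, h0⟩ := hz
    rw [Finset.prod_eq_zero hB h0, mul_zero]
    refine (Finset.sum_eq_zero fun i _ => ?_).le
    have : y B (fun j => i j.1) = 0 := by
      have := abs_le_pNorm hp (y B) (fun j => i j.1)
      rw [h0] at this
      exact abs_nonpos_iff.1 this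
    rw [blockTensor, Finset.prod_eq_zero hB this, mul_zero]
  push Not at hz
  have hpos : 0 < ∏ B ∈ π, pNorm p (y B) :=
    Finset.prod_pos fun B hB => lt_of_le_of_ne (pNorm_nonneg p _) (hz B hB).symm
  rw [← div_le_iff₀ hpos]
  refine le_csSup ?_ ⟨fun B v => (pNorm p (y B))⁻¹ * y B v, fun B hB => ?_, ?_⟩
  · refine ⟨∑ i, |A i|, ?_⟩
    rintro _ ⟨z, hz, rfl⟩
    refine Finset.sum_le_sum fun i _ => (le_abs_self _).trans ?_
    rw [abs_mul, Finset.abs_prod]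
    refine mul_le_of_le_one_right (abs_nonneg _) ?_
    exact Finset.prod_le_one (fun _ _ => abs_nonneg _) fun B hB =>
      hz B hB ▸ abs_le_pNorm hp (z B) _
  · rw [pNorm_const_mul hp (inv_nonneg.2 (pNorm_nonneg p _)), inv_mul_cancel₀ (hz B hB)]
  · rw [Finset.sum_div]
    refine Finset.sum_congr rfl fun i _ => ?_
    rw [Finset.prod_mul_distrib, Finset.prod_inv_distrib, blockTensor]
    ring

lemma unfoldNormP_nonneg {p : ℝ≥0∞} (hp : 1 ≤ p) (hd : ∀ n, 1 ≤ d n)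
    (A : ((n : Fin k) → Fin (d n)) → ℝ) (hπ : π.Nonempty) : 0 ≤ unfoldNormP p d A π := by
  obtain ⟨B₀, hB₀⟩ := hπ
  have hne (n : Fin k) : Nonempty (Fin (d n)) := ⟨⟨0, hd n⟩⟩
  have h1 := inner_blockTensor_le hp A π fun _ _ => 1
  have h2 := inner_blockTensor_le hp A π fun B _ => if B = B₀ then -1 else 1
  have hnorm (B : Finset (Fin k)) :
      pNorm p (fun _ : (j : B) → Fin (d j.1) => if B = B₀ then (-1 : ℝ) else 1) =
        pNorm p (fun _ : (j : B) → Fin (d j.1) => (1 : ℝ)) := by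
    split_ifs
    · exact pNorm_neg p _
    · rfl
  simp only [hnorm] at h2
  have hpos : 0 < ∏ B ∈ π, pNorm p (fun _ : (j : B) → Fin (d j.1) => (1 : ℝ)) :=
    Finset.prod_pos fun B _ => by
      have := abs_le_pNorm hp (fun _ : (j : B) → Fin (d j.1) => (1 : ℝ))
        (fun j => Classical.arbitrary _)
      rw [abs_one] at this
      linarith
  simp [blockTensor, Finset.prod_ite_eq', hB₀] at h1 h2
  by_contra! hneg
  have := mul_neg_of_neg_of_pos hneg hpos
  linarith

/-- The restriction of a tensor to the multi-indices that agree with `j` on `S`. -/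
noncomputable def slice (S : Finset (Fin k)) (F : ((n : Fin k) → Fin (d n)) → ℝ)
    (j i : (n : Fin k) → Fin (d n)) : ℝ :=
  if ∀ n ∈ S, i n = j n then F i else 0

/-- The number of multi-indices that agree with a given one on `S`. -/
def sliceCard (d : Fin k → ℕ) (S : Finset (Fin k)) : ℕ := ∏ n, if n ∈ S then 1 else d n

lemma sum_slice (S : Finset (Fin k)) (F : ((n : Fin k) → Fin (d n)) → ℝ)
    (i : (n : Fin k) → Fin (d n)) : ∑ j, slice S F j i = sliceCard d S * F i := by
  have : (Finset.univ.filter fun j : (n : Fin k) → Fin (d n) => ∀ n ∈ S, i n = j n) =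
      Fintype.piFinset fun n => if n ∈ S then {i n} else Finset.univ := by
    ext j
    simp only [Finset.mem_filter, Finset.mem_univ, true_and, Fintype.mem_piFinset]
    refine forall_congr' fun n => ?_
    split_ifs with h <;> simp [h, eq_comm]
  simp only [slice]
  rw [← Finset.sum_filter, this, Finset.sum_const, Fintype.card_piFinset, nsmul_eq_mul, sliceCard]
  congr 3
  funext n
  split_ifs <;> simp

lemma sum_pNorm_slice_le {p : ℝ≥0∞} (hp : 1 ≤ p) (S : Finset (Fin k))
    (F : ((n : Fin k) → Fin (d n)) → ℝ) (hF : pNorm p F = 1) :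
    ∑ j, pNorm p (slice S F j) ≤
      (∏ n, (d n : ℝ)) ^ (1 - (1 / p).toReal) * (sliceCard d S : ℝ) ^ (1 / p).toReal := by
  by_cases h : p = ⊤
  · subst h
    have hle (j : (n : Fin k) → Fin (d n)) : pNorm ⊤ (slice S F j) ≤ 1 := by
      rw [pNorm, if_pos rfl]
      refine Real.iSup_le (fun i => ?_) zero_le_one
      unfold slice
      split_ifs
      · exact hF ▸ abs_le_pNorm hp F i
      · simp
    refine (Finset.sum_le_sum fun j _ => hle j).trans ?_
    simp
  · have hq := toReal_pos_of_one_le hp h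
    have hq1 : 1 ≤ p.toReal := by
      rw [← ENNReal.toReal_one]; exact ENNReal.toReal_mono h hp
    have hsum : ∑ i, |F i| ^ p.toReal = 1 := by
      rw [pNorm, if_neg h, one_div, Real.rpow_inv_eq (by positivity) zero_le_one hq.ne',
        Real.one_rpow] at hF
      exact hF
    have hpow : ∑ j, |pNorm p (slice S F j)| ^ p.toReal = sliceCard d S := by
      have (j : (n : Fin k) → Fin (d n)) : |pNorm p (slice S F j)| ^ p.toReal =
          ∑ i, slice S (fun i => |F i| ^ p.toReal) j i := by
        rw [abs_of_nonneg (pNorm_nonneg _ _), pNorm, if_neg h, one_div,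
          Real.rpow_inv_rpow (by positivity) hq.ne']
        refine Finset.sum_congr rfl fun i _ => ?_
        unfold slice
        split_ifs <;> simp [hq.ne']
      simp_rw [this]
      rw [Finset.sum_comm]
      simp_rw [sum_slice, ← Finset.mul_sum, hsum, mul_one]
    have key := Real.rpow_sum_le_const_mul_sum_rpow Finset.univ
      (fun j => pNorm p (slice S F j)) hq1
    rw [hpow] at key
    simp_rw [abs_of_nonneg (pNorm_nonneg _ _)] at key
    have h0 : 0 ≤ ∑ j, pNorm p (slice S F j) := Finset.sum_nonneg fun j _ => pNorm_nonneg _ _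
    have := (Real.le_rpow_inv_iff_of_pos h0 (by positivity) hq).2 key
    refine this.trans_eq ?_
    rw [Real.mul_rpow (by positivity) (by positivity), ← Real.rpow_mul (by positivity)]
    simp only [Finset.card_univ, Fintype.card_pi, Fintype.card_fin, Nat.cast_prod, one_div,
      ENNReal.toReal_inv]
    congr 2
    field_simp

lemma exists_blockTensor_eq_slice {π₁ π₂ : Finset (Finset (Fin k))} (h₁ : IsPartition π₁)
    (c : Finset (Fin k) → Finset (Fin k)) (hc : ∀ B ∈ π₂, c B ∈ π₁) (S : Finset (Fin k))
    (hS : ∀ B ∈ π₂, ∀ n ∈ B, n ∉ c B → n ∈ S)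
    (y : (B : Finset (Fin k)) → ((j : B) → Fin (d j.1)) → ℝ) (j : (n : Fin k) → Fin (d n)) :
    ∃ z : (B : Finset (Fin k)) → ((j : B) → Fin (d j.1)) → ℝ,
      blockTensor π₁ z = slice S (blockTensor π₂ y) j := by
  classical
  refine ⟨fun B' v => (if ∀ n : B', n.1 ∈ S → v n = j n then 1 else 0) *
    ∏ B ∈ π₂ with c B = B', y B fun m => if hm : m.1 ∈ B' then v ⟨m.1, hm⟩ else j m, ?_⟩
  funext i
  unfold slice
  split_ifs with hij
  · simp only [blockTensor]
    rw [← Finset.prod_fiberwise_of_maps_to hc]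
    refine Finset.prod_congr rfl fun B' _ => ?_
    rw [if_pos fun (n : B') hn => hij n.1 hn, one_mul]
    refine Finset.prod_congr rfl fun B hB => ?_
    obtain ⟨hBπ, rfl⟩ := Finset.mem_filter.1 hB
    congr 1
    funext m
    split_ifs with hm
    · rfl
    · exact (hij _ (hS B hBπ m.1 m.2 hm)).symm
  · push Not at hij
    obtain ⟨n, hn, hne⟩ := hij
    obtain ⟨B', hB', hnB'⟩ := h₁.exists_mem n
    refine Finset.prod_eq_zero hB' ?_
    dsimp only
    rw [if_neg fun hall => hne (hall ⟨n, hnB'⟩ hn), zero_mul]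

lemma IsPartition.prod_prod (h : IsPartition π) (f : Fin k → ℕ) :
    ∏ B ∈ π, ∏ n ∈ B, f n = ∏ n, f n := by
  have hdisj : (π : Set (Finset (Fin k))).PairwiseDisjoint id :=
    fun B hB B' hB' hne => h.2.1 B hB B' hB' hne
  have := Finset.prod_biUnion (f := f) hdisj
  rw [← Finset.sup_eq_biUnion, h.2.2] at this
  exact this.symm

lemma dimRel_pos {π₁ π₂ : Finset (Finset (Fin k))} (hd : ∀ n, 1 ≤ d n) (h₁ : IsPartition π₁)
    (h₂ : IsPartition π₂) : 0 < dimRel d π₁ π₂ := by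
  refine Finset.prod_pos fun B hB => ?_
  obtain ⟨n, hn⟩ := h₁.1 B hB
  obtain ⟨B', hB', hn'⟩ := h₂.exists_mem n
  refine lt_of_lt_of_le ?_ (Finset.le_sup (f := fun B' => blockDim d B B') hB')
  rw [blockDim, if_pos ⟨n, Finset.mem_inter.2 ⟨hn, hn'⟩⟩]
  exact Finset.prod_pos fun n _ => hd n

/-- There is a choice of blocks `c B ∈ π₁`, for `B ∈ π₂`, such that `dim_A(π₂, π₁)` is at most the
product of the dimensions `d n` over the indices outside `⋃ B ∈ π₂, B \ c B`. -/
lemma exists_dimRel_le_sliceCard {π₁ π₂ : Finset (Finset (Fin k))} (h₂ : IsPartition π₂)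
    (hne : π₁.Nonempty) :
    ∃ (c : Finset (Fin k) → Finset (Fin k)) (S : Finset (Fin k)), (∀ B ∈ π₂, c B ∈ π₁) ∧
      (∀ B ∈ π₂, ∀ n ∈ B, n ∉ c B → n ∈ S) ∧ dimRel d π₂ π₁ ≤ sliceCard d S := by
  have hmax (B : Finset (Fin k)) := Finset.exists_mem_eq_sup π₁ hne fun B' => blockDim d B B'
  choose c hc hsup using hmax
  refine ⟨c, π₂.biUnion fun B => B \ c B, fun B _ => hc B, fun B hB n hn hn' =>
    Finset.mem_biUnion.2 ⟨B, hB, Finset.mem_sdiff.2 ⟨hn, hn'⟩⟩, ?_⟩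
  rw [sliceCard, ← h₂.prod_prod]
  refine Finset.prod_le_prod' fun B hB => ?_
  rw [hsup]
  have hle : blockDim d B (c B) ≤ ∏ n ∈ B ∩ c B, d n := by
    unfold blockDim
    split_ifs
    · exact le_rfl
    · exact Nat.zero_le _
  refine hle.trans_eq ?_
  rw [← Finset.filter_mem_eq_inter, Finset.prod_filter]
  refine Finset.prod_congr rfl fun n hn => ?_
  have : n ∈ (π₂.biUnion fun B => B \ c B) ↔ n ∉ c B := by
    simp only [Finset.mem_biUnion, Finset.mem_sdiff]
    constructor
    · rintro ⟨B', hB', hn', hnc⟩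
      rwa [h₂.eq_of_mem hB hB' hn hn']
    · exact fun hnc => ⟨B, hB, hn, hnc⟩
  simp only [this]
  split_ifs <;> simp_all

lemma unfoldNormP_le {p : ℝ≥0∞} (hp : 2 ≤ p) (hd : ∀ n, 1 ≤ d n)
    (A : ((n : Fin k) → Fin (d n)) → ℝ) {π₁ π₂ : Finset (Finset (Fin k))}
    (h₁ : IsPartition π₁) (h₂ : IsPartition π₂) :
    unfoldNormP p d A π₂ ≤
      (∏ n : Fin k, (d n : ℝ)) ^ (1 - (1 / p).toReal) * (dimRel d π₂ π₁ : ℝ) ^ (-(1 / 2) : ℝ) *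
        unfoldNormP p d A π₁ := by
  have hp1 : 1 ≤ p := le_trans (by norm_num) hp
  rcases π₁.eq_empty_or_nonempty with rfl | hne
  · have hk (n : Fin k) : False := by simpa using h₁.exists_mem n
    obtain rfl : π₂ = ∅ := Finset.eq_empty_of_forall_notMem fun B hB =>
      hk (h₂.1 B hB).choose
    have : IsEmpty (Fin k) := ⟨hk⟩
    simp [dimRel]
  have hM := unfoldNormP_nonneg hp1 hd A hne
  obtain ⟨c, S, hc, hS, hD⟩ := exists_dimRel_le_sliceCard (d := d) h₂ hne
  have hD0 := dimRel_pos hd h₂ h₁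
  refine Real.sSup_le ?_ (by positivity)
  rintro _ ⟨y, hy, rfl⟩
  set M := unfoldNormP p d A π₁
  set N : ℝ := ∏ n : Fin k, (d n : ℝ)
  set F := blockTensor π₂ y
  have hF : pNorm p F = 1 := by
    rw [h₂.pNorm_blockTensor hd]
    exact Finset.prod_eq_one hy
  have hslice (j : (n : Fin k) → Fin (d n)) :
      ∑ i, A i * slice S F j i ≤ M * pNorm p (slice S F j) := by
    obtain ⟨z, hz⟩ := exists_blockTensor_eq_slice h₁ c hc S hS y j
    rw [← hz, h₁.pNorm_blockTensor hd]
    exact inner_blockTensor_le hp1 A π₁ z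
  have hC1 : (1 : ℝ) ≤ dimRel d π₂ π₁ := by exact_mod_cast hD0
  have hDC : (dimRel d π₂ π₁ : ℝ) ≤ sliceCard d S := by exact_mod_cast hD
  set C : ℝ := (sliceCard d S : ℝ)
  have hC0 : 0 < C := by linarith
  have hmul : C * ∑ i, A i * F i ≤ M * (N ^ (1 - (1 / p).toReal) * C ^ (1 / p).toReal) :=
    calc C * ∑ i, A i * F i = ∑ j, ∑ i, A i * slice S F j i := by
          rw [Finset.sum_comm, Finset.mul_sum]
          refine Finset.sum_congr rfl fun i _ => ?_
          rw [← Finset.mul_sum, sum_slice]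
          ring
      _ ≤ ∑ j, M * pNorm p (slice S F j) := Finset.sum_le_sum fun j _ => hslice j
      _ ≤ _ := by
          rw [← Finset.mul_sum]
          exact mul_le_mul_of_nonneg_left (sum_pNorm_slice_le hp1 S F hF) hM
  have hinv : (1 / p).toReal ≤ 1 / 2 := by
    have h := ENNReal.toReal_mono (by simp) (ENNReal.inv_le_inv.2 hp)
    simpa using h
  have hexp : C ^ (1 / p).toReal ≤ C * (dimRel d π₂ π₁ : ℝ) ^ (-(1 / 2) : ℝ) :=
    calc C ^ (1 / p).toReal ≤ C ^ (1 + -(1 / 2) : ℝ) :=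
          Real.rpow_le_rpow_of_exponent_le (hC1.trans hDC) (by linarith)
      _ = C * C ^ (-(1 / 2) : ℝ) := by rw [Real.rpow_add hC0, Real.rpow_one]
      _ ≤ _ := mul_le_mul_of_nonneg_left
          (Real.rpow_le_rpow_of_nonpos (by linarith) hDC (by norm_num)) hC0.le
  have hN : 0 ≤ N ^ (1 - (1 / p).toReal) := by positivity
  refine le_of_mul_le_mul_left (hmul.trans ?_) hC0
  calc M * (N ^ (1 - (1 / p).toReal) * C ^ (1 / p).toReal)
      ≤ M * (N ^ (1 - (1 / p).toReal) * (C * (dimRel d π₂ π₁ : ℝ) ^ (-(1 / 2) : ℝ))) := by gcongr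
    _ = _ := by ring

end TensorUnfolding

open TensorUnfolding in
/-- **`l^p`-norm inequalities, `2 ≤ p ≤ ∞`.** For any two
partitions `π₁, π₂` of `[k]` (with the convention `1/∞ = 0`),
`[dim(A)]^{1/p − 1} [dim_A(π₁,π₂)]^{1/2} ‖Unfold_{π₁}(A)‖_p ≤ ‖Unfold_{π₂}(A)‖_p ≤
 [dim(A)]^{1 − 1/p} [dim_A(π₂,π₁)]^{−1/2} ‖Unfold_{π₁}(A)‖_p`. -/
theorem lp_norm_inequalities_high {k : ℕ} (d : Fin k → ℕ) (hd : ∀ n, 1 ≤ d n)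
    (A : ((n : Fin k) → Fin (d n)) → ℝ)
    (π₁ π₂ : Finset (Finset (Fin k)))
    (h₁ : IsPartition π₁) (h₂ : IsPartition π₂)
    (p : ℝ≥0∞) (hp1 : 2 ≤ p) (hp2 : p ≤ ⊤) :
    (∏ n : Fin k, (d n : ℝ)) ^ ((1 / p).toReal - 1) * (dimRel d π₁ π₂ : ℝ) ^ ((1 : ℝ) / 2) *
        unfoldNormP p d A π₁ ≤ unfoldNormP p d A π₂ ∧
    unfoldNormP p d A π₂ ≤
      (∏ n : Fin k, (d n : ℝ)) ^ (1 - (1 / p).toReal) * (dimRel d π₂ π₁ : ℝ) ^ (-(1 / 2) : ℝ) *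
        unfoldNormP p d A π₁ := by
  refine ⟨?_, unfoldNormP_le hp1 hd A h₁ h₂⟩
  have h := unfoldNormP_le hp1 hd A h₂ h₁
  have hN : 0 < ∏ n : Fin k, (d n : ℝ) :=
    Finset.prod_pos fun n _ => by exact_mod_cast hd n
  have hD : (0 : ℝ) < dimRel d π₁ π₂ := by exact_mod_cast dimRel_pos hd h₁ h₂
  refine (mul_le_mul_of_nonneg_left h (by positivity)).trans_eq ?_
  rw [← neg_sub 1 (1 / p).toReal, Real.rpow_neg hN.le, Real.rpow_neg hD.le]
  have := (Real.rpow_pos_of_pos hN (1 - (1 / p).toReal)).ne'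
  have := (Real.rpow_pos_of_pos hD (1 / 2)).ne'
  field_simp
end

section
/- Let A be an order-k real tensor with dimensions (d₁,…,d_k) and let π be a partition of [k]. If A is π-orthogonal decomposable, then for every partition τ in the upper cone U_π = { τ : π ≤ τ and τ ≠ 1_{[k]} } of π, one has ‖Unfold_τ(A)‖_σ = ‖Unfold_π(A)‖_σ. -/
open scoped BigOperators ENNReal

namespace TensorUnfolding

/-- Bessel's inequality in coordinates. -/
lemma sum_sq_dotProduct_le_one {ι V : Type*} [Fintype ι] [DecidableEq ι] [Fintype V]
    (e : ι → V → ℝ) (he : ∀ n m, ∑ v, e n v * e m v = if n = m then 1 else 0)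
    (y : V → ℝ) (hy : ∑ v, y v ^ 2 = 1) :
    ∑ n, (∑ v, e n v * y v) ^ 2 ≤ 1 := by
  have ho : Orthonormal ℝ fun n => (WithLp.toLp 2 (e n) : EuclideanSpace ℝ V) := by
    rw [orthonormal_iff_ite]
    intro n m
    rw [← he n m]
    simp [PiLp.inner_apply, mul_comm]
  have h := ho.sum_inner_products_le (x := (WithLp.toLp 2 y : EuclideanSpace ℝ V))
    (s := Finset.univ)
  rw [EuclideanSpace.norm_sq_eq] at h
  simpa [PiLp.inner_apply, mul_comm, hy] using h

namespace IsPartition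

variable {k : ℕ} {π τ : Finset (Finset (Fin k))}

lemma exists_mem_s15 (hπ : IsPartition π) (n : Fin k) : ∃ B ∈ π, n ∈ B := by
  have h : n ∈ π.sup id := hπ.2.2 ▸ Finset.mem_univ n
  simpa [Finset.mem_sup] using h

lemma eq_of_mem_s15 (hπ : IsPartition π) {B B' : Finset (Fin k)} (hB : B ∈ π) (hB' : B' ∈ π)
    {n : Fin k} (h : n ∈ B) (h' : n ∈ B') : B = B' := by
  by_contra hne
  exact Finset.disjoint_left.1 (hπ.2.1 B hB B' hB' hne) h h'

lemma prod_univ_eq (hπ : IsPartition π) (f : Fin k → ℝ) :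
    ∏ n, f n = ∏ B ∈ π, ∏ j ∈ B, f j := by
  rw [← hπ.2.2, Finset.sup_eq_biUnion, Finset.prod_biUnion]
  · rfl
  · exact fun B hB B' hB' hne => hπ.2.1 B hB B' hB' hne

lemma restrict_bijective (hπ : IsPartition π) (d : Fin k → ℕ) :
    Function.Bijective
      (fun (i : (n : Fin k) → Fin (d n)) (B : π) (j : B.1) => i j.1) := by
  choose b hb hnb using hπ.exists_mem_s15
  constructor
  · intro i i' h
    funext n
    exact congrFun (congrFun h ⟨b n, hb n⟩) ⟨n, hnb n⟩
  · intro g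
    refine ⟨fun n => g ⟨b n, hb n⟩ ⟨n, hnb n⟩, ?_⟩
    funext ⟨B, hB⟩ ⟨j, hj⟩
    have h := hπ.eq_of_mem_s15 (hb j) hB (hnb j) hj
    subst h
    rfl

lemma sum_prod_restrict (hπ : IsPartition π) (d : Fin k → ℕ)
    (f : (B : Finset (Fin k)) → ((j : B) → Fin (d j.1)) → ℝ) :
    ∑ i : (n : Fin k) → Fin (d n), ∏ B ∈ π, f B (fun j => i j.1) =
      ∏ B ∈ π, ∑ v, f B v := by
  rw [← Finset.prod_coe_sort π, Finset.prod_univ_sum, Fintype.piFinset_univ]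
  refine Fintype.sum_bijective _ (hπ.restrict_bijective d) _ _ fun i => ?_
  exact (Finset.prod_coe_sort π fun B => f B fun j => i j.1).symm

/-- Blocks of a coarser partition are unions of blocks of the finer one. -/
lemma prod_block_eq (hπ : IsPartition π) (hτ : IsPartition τ) (h : Refines π τ)
    {C : Finset (Fin k)} (hC : C ∈ τ) (f : Fin k → ℝ) :
    ∏ j ∈ C, f j = ∏ B ∈ π with B ⊆ C, ∏ j ∈ B, f j := by
  rw [← Finset.prod_biUnion]
  · congr 1
    ext n
    simp only [Finset.mem_biUnion, Finset.mem_filter]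
    constructor
    · intro hn
      obtain ⟨B, hB, hnB⟩ := hπ.exists_mem_s15 n
      obtain ⟨C', hC', hBC'⟩ := h B hB
      obtain rfl := hτ.eq_of_mem_s15 hC hC' hn (hBC' hnB)
      exact ⟨B, ⟨hB, hBC'⟩, hnB⟩
    · rintro ⟨B, ⟨-, hBC⟩, hnB⟩
      exact hBC hnB
  · intro B hB B' hB' hne
    exact hπ.2.1 B (Finset.mem_filter.1 hB).1 B' (Finset.mem_filter.1 hB').1 hne

lemma nonempty_subblocks (hπ : IsPartition π) (hτ : IsPartition τ) (h : Refines π τ)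
    {C : Finset (Fin k)} (hC : C ∈ τ) : ({B ∈ π | B ⊆ C}).Nonempty := by
  obtain ⟨n, hn⟩ := hτ.1 C hC
  obtain ⟨B, hB, hnB⟩ := hπ.exists_mem_s15 n
  obtain ⟨C', hC', hBC'⟩ := h B hB
  obtain rfl := hτ.eq_of_mem_s15 hC hC' hn (hBC' hnB)
  exact ⟨B, Finset.mem_filter.2 ⟨hB, hBC'⟩⟩

lemma nontrivial_of_ne_top [NeZero k] (hτ : IsPartition τ) (hne : τ ≠ topPartition k) :
    ∃ C ∈ τ, ∃ C' ∈ τ, C ≠ C' := by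
  obtain ⟨C, hC, -⟩ := hτ.exists_mem_s15 0
  by_contra! hall
  have hs : τ = {C} :=
    Finset.eq_singleton_iff_unique_mem.2 ⟨hC, fun C' hC' => (hall C hC C' hC').symm⟩
  apply hne
  have hu := hτ.2.2
  rw [hs, Finset.sup_singleton] at hu
  rw [hs, topPartition, ← hu]
  rfl

lemma nontrivial_of_refines (hπ : IsPartition π) (hτ : IsPartition τ) (h : Refines π τ)
    (hne : ∃ C ∈ τ, ∃ C' ∈ τ, C ≠ C') : ∃ B ∈ π, ∃ B' ∈ π, B ≠ B' := by
  obtain ⟨C, hC, C', hC', hCC'⟩ := hne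
  obtain ⟨B, hB⟩ := hπ.nonempty_subblocks hτ h hC
  obtain ⟨B', hB'⟩ := hπ.nonempty_subblocks hτ h hC'
  rw [Finset.mem_filter] at hB hB'
  refine ⟨B, hB.1, B', hB'.1, ?_⟩
  rintro rfl
  obtain ⟨n, hn⟩ := hπ.1 B hB.1
  exact hCC' (hτ.eq_of_mem_s15 hC hC' (hB.2 hn) (hB'.2 hn))

end IsPartition

section Decomposition

variable {k r : ℕ} {d : Fin k → ℕ} {π τ : Finset (Finset (Fin k))}
  {A : ((n : Fin k) → Fin (d n)) → ℝ} {lam : Fin r → ℝ}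
  {a : Fin r → (n : Fin k) → Fin (d n) → ℝ}

lemma orthogonal_of_refines (hπ : IsPartition π) (hτ : IsPartition τ) (h : Refines π τ)
    (ha : ∀ B ∈ π, ∀ n m : Fin r,
      (∏ j ∈ B, ∑ t, a n j t * a m j t) = if n = m then 1 else 0) :
    ∀ C ∈ τ, ∀ n m : Fin r,
      (∏ j ∈ C, ∑ t, a n j t * a m j t) = if n = m then 1 else 0 := by
  intro C hC n m
  rw [hπ.prod_block_eq hτ h hC,
    Finset.prod_congr rfl fun B hB => ha B (Finset.mem_filter.1 hB).1 n m]
  obtain ⟨B, hB⟩ := hπ.nonempty_subblocks hτ h hC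
  split_ifs
  · simp
  · exact Finset.prod_eq_zero hB rfl

lemma sum_prod_mul_prod (B : Finset (Fin k)) (x y : (n : Fin k) → Fin (d n) → ℝ) :
    ∑ v : (j : B) → Fin (d j.1), (∏ j : B, x j.1 (v j)) * ∏ j : B, y j.1 (v j) =
      ∏ j ∈ B, ∑ t, x j t * y j t := by
  rw [← Finset.prod_coe_sort B, Finset.prod_univ_sum, Fintype.piFinset_univ]
  simp_rw [Finset.prod_mul_distrib]

lemma contraction_eq (hπ : IsPartition π) (hA : ∀ i, A i = ∑ n, lam n * ∏ m, a n m (i m))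
    (y : (B : Finset (Fin k)) → ((j : B) → Fin (d j.1)) → ℝ) :
    ∑ i, A i * ∏ B ∈ π, y B (fun j => i j.1) =
      ∑ n, lam n * ∏ B ∈ π, ∑ v, (∏ j : B, a n j.1 (v j)) * y B v := by
  simp_rw [hA, Finset.sum_mul]
  rw [Finset.sum_comm]
  refine Finset.sum_congr rfl fun n _ => ?_
  rw [← hπ.sum_prod_restrict d fun B v => (∏ j : B, a n j.1 (v j)) * y B v, Finset.mul_sum]
  refine Finset.sum_congr rfl fun i _ => ?_
  rw [hπ.prod_univ_eq, mul_assoc, ← Finset.prod_mul_distrib]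
  congr 1
  refine Finset.prod_congr rfl fun B _ => ?_
  rw [← Finset.prod_coe_sort B]

lemma sum_mul_prod_le {β : Type*} [DecidableEq β] {s : Finset β} {b b' : β} (hb : b ∈ s)
    (hb' : b' ∈ s) (hne : b ≠ b') {ι : Type*} [Fintype ι] {w : ι → ℝ} {M : ℝ}
    (hw : ∀ n, 0 ≤ w n) (hM : ∀ n, w n ≤ M) (hM0 : 0 ≤ M) (c : ι → β → ℝ)
    (hc : ∀ b ∈ s, ∑ n, c n b ^ 2 ≤ 1) :
    ∑ n, w n * ∏ b ∈ s, c n b ≤ M := by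
  have hc1 : ∀ b ∈ s, ∀ n, |c n b| ≤ 1 := fun b hb n =>
    (sq_le_one_iff_abs_le_one _).1 ((Finset.single_le_sum
      (f := fun n => c n b ^ 2) (fun _ _ => sq_nonneg _) (Finset.mem_univ n)).trans (hc b hb))
  have hterm : ∀ n, w n * ∏ b ∈ s, c n b ≤ M * ((c n b ^ 2 + c n b' ^ 2) / 2) := by
    intro n
    have hsub : ({b, b'} : Finset β) ⊆ s := by
      simp [Finset.insert_subset_iff, hb, hb']
    have hp : ∏ b ∈ s, |c n b| ≤ |c n b| * |c n b'| := by
      rw [← Finset.prod_sdiff hsub, Finset.prod_pair hne]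
      exact mul_le_of_le_one_left (by positivity)
        (Finset.prod_le_one (fun _ _ => abs_nonneg _)
          fun i hi => hc1 i (Finset.mem_sdiff.1 hi).1 n)
    have hq : |c n b| * |c n b'| ≤ (c n b ^ 2 + c n b' ^ 2) / 2 := by
      nlinarith [sq_nonneg (|c n b| - |c n b'|), sq_abs (c n b), sq_abs (c n b')]
    calc w n * ∏ b ∈ s, c n b ≤ w n * ∏ b ∈ s, |c n b| :=
          mul_le_mul_of_nonneg_left ((le_abs_self _).trans_eq (Finset.abs_prod _ _)) (hw n)
      _ ≤ M * ((c n b ^ 2 + c n b' ^ 2) / 2) :=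
          mul_le_mul (hM n) (hp.trans hq) (Finset.prod_nonneg fun _ _ => abs_nonneg _) hM0
  calc ∑ n, w n * ∏ b ∈ s, c n b ≤ ∑ n, M * ((c n b ^ 2 + c n b' ^ 2) / 2) :=
        Finset.sum_le_sum fun n _ => hterm n
    _ = M * ((∑ n, c n b ^ 2 + ∑ n, c n b' ^ 2) / 2) := by
        rw [← Finset.mul_sum, ← Finset.sum_div, Finset.sum_add_distrib]
    _ ≤ M := mul_le_of_le_one_right hM0 (by linarith [hc b hb, hc b' hb'])

/-- The spectral norm of an unfolding with at least two blocks along which the decomposition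
is orthogonal is the largest coefficient. -/
lemma unfoldNorm_eq_of_orthogonal (hπ : IsPartition π) (hnt : ∃ B ∈ π, ∃ B' ∈ π, B ≠ B')
    (n₀ : Fin r) (hle : ∀ n, lam n ≤ lam n₀) (hlam : ∀ n, 0 ≤ lam n)
    (hA : ∀ i, A i = ∑ n, lam n * ∏ m, a n m (i m))
    (ha : ∀ B ∈ π, ∀ n m : Fin r,
      (∏ j ∈ B, ∑ t, a n j t * a m j t) = if n = m then 1 else 0) :
    unfoldNorm d A π = lam n₀ := by
  obtain ⟨B, hB, B', hB', hne⟩ := hnt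
  refine IsGreatest.csSup_eq ⟨⟨fun B v => ∏ j : B, a n₀ j.1 (v j), ?_, ?_⟩, ?_⟩
  · intro C hC
    simp_rw [sq]
    rw [sum_prod_mul_prod, ha C hC, if_pos rfl]
  · rw [contraction_eq hπ hA fun B v => ∏ j : B, a n₀ j.1 (v j), Finset.sum_eq_single n₀]
    · rw [Finset.prod_eq_one, mul_one]
      intro C hC
      rw [sum_prod_mul_prod, ha C hC, if_pos rfl]
    · intro n _ hn
      rw [Finset.prod_eq_zero hB, mul_zero]
      rw [sum_prod_mul_prod, ha B hB, if_neg hn]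
    · simp
  · rintro _ ⟨y, hy, rfl⟩
    rw [contraction_eq hπ hA]
    refine sum_mul_prod_le hB hB' hne hlam hle (hlam n₀)
      (fun n B => ∑ v, (∏ j : B, a n j.1 (v j)) * y B v) fun C hC => ?_
    refine sum_sq_dotProduct_le_one (fun n (v : (j : C) → Fin (d j.1)) => ∏ j : C, a n j.1 (v j))
      (fun n m => ?_) (y C) (hy C hC)
    rw [sum_prod_mul_prod, ha C hC]

lemma unfoldNorm_of_eq_zero (hA : ∀ i, A i = 0) : unfoldNorm d A π = 0 := by
  unfold unfoldNorm
  apply le_antisymm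
  · apply Real.sSup_nonpos
    rintro _ ⟨y, -, rfl⟩
    simp [hA]
  · apply Real.sSup_nonneg
    rintro _ ⟨y, -, rfl⟩
    simp [hA]

end Decomposition

end TensorUnfolding

open TensorUnfolding in
/-- **Norm equality on upper cones.** If `A` is `π`-orthogonal
decomposable, then for every partition `τ` in the upper cone
`U_π = { τ : π ≤ τ, τ ≠ 1_{[k]} }` of `π`,
`‖Unfold_τ(A)‖_σ = ‖Unfold_π(A)‖_σ`. -/
theorem upper_cone_equality {k : ℕ} (d : Fin k → ℕ) (hd : ∀ n, 1 ≤ d n)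
    (A : ((n : Fin k) → Fin (d n)) → ℝ)
    (π : Finset (Finset (Fin k))) (hπ : IsPartition π) (hOD : IsPiOD d A π) :
    ∀ τ : Finset (Finset (Fin k)), IsPartition τ → Refines π τ →
      τ ≠ topPartition k →
      unfoldNorm d A τ = unfoldNorm d A π := by
  intro τ hτ h hne
  obtain ⟨r, lam, a, hmono, hlam, hA, ha⟩ := hOD
  rcases Nat.eq_zero_or_pos r with rfl | hr
  · have hA0 : ∀ i, A i = 0 := fun i => by simp [hA i]
    rw [unfoldNorm_of_eq_zero hA0, unfoldNorm_of_eq_zero hA0]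
  rcases Nat.eq_zero_or_pos k with rfl | hk
  · have hempty : ∀ {σ : Finset (Finset (Fin 0))}, IsPartition σ → σ = ∅ := fun hσ =>
      Finset.eq_empty_of_forall_notMem fun B hB => (hσ.1 B hB).elim fun n _ => n.elim0
    rw [hempty hτ, hempty hπ]
  have : NeZero k := ⟨hk.ne'⟩
  have : NeZero r := ⟨hr.ne'⟩
  have hnt := hτ.nontrivial_of_ne_top hne
  have hle : ∀ n, lam n ≤ lam 0 := fun n => hmono (Fin.zero_le n)
  rw [unfoldNorm_eq_of_orthogonal hτ hnt 0 hle hlam hA (orthogonal_of_refines hπ hτ h ha),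
    unfoldNorm_eq_of_orthogonal hπ (hπ.nontrivial_of_refines hτ h hnt) 0 hle hlam hA ha]
end
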